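/- Consider the location-family random utility model on m alternatives in which the noise densities are Gaussian with fixed positive standard deviations σ_1,…,σ_m: f_j(x) = (1/(σ_j√(2π))) · exp(−x²/(2σ_j²)). For a permutation π of {1,…,m} and θ ∈ ℝ^m define Pr(π|θ) = ∫_{A_π} ∏_{j=1}^m f_j(x_j − θ_j) dx, where A_π = {x ∈ ℝ^m : x_{π(1)} > x_{π(2)} > ⋯ > x_{π(m)}}. Then for any data D = (π^1,…,π^n) of n rankings, the log-likelihood l(θ;D) = ∑_{i=1}^n log Pr(π^i|θ) is concave in θ on ℝ^m. -/

import Mathlib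

open MeasureTheory

/-- The probability that the ranking `π` is realized in a location-family random
utility model with noise densities `f j` and location parameters `θ j`. -/
noncomputable def rumProb {m : ℕ} (f : Fin m → ℝ → ℝ) (θ : Fin m → ℝ)
    (π : Equiv.Perm (Fin m)) : ℝ :=
  ∫ x in {x : Fin m → ℝ | ∀ k l : Fin m, k < l → x (π l) < x (π k)},
    ∏ j, f j (x j - θ j)

open scoped ENNReal Pointwise

lemma volume_image_mul_add {a : ℝ} (ha : 0 < a) (c : ℝ) (K : Set ℝ) :
    volume ((fun x => a * x + c) '' K) = ENNReal.ofReal a * volume K := by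
  have h : (fun x => a * x + c) '' K = (fun z => z + c) '' (a • K) := by
    rw [← Set.image_smul, Set.image_image]; rfl
  rw [h, Set.image_add_right, measure_preimage_add_right, Measure.addHaar_smul]
  simp [abs_of_pos ha]

lemma brunn_minkowski_real_of_isCompact {a b : ℝ} (ha : 0 < a) (hb : 0 < b) {K L S : Set ℝ}
    (hK : IsCompact K) (hL : IsCompact L) (hK0 : K.Nonempty) (hL0 : L.Nonempty)
    (h : ∀ x ∈ K, ∀ y ∈ L, a * x + b * y ∈ S) :
    ENNReal.ofReal a * volume K + ENNReal.ofReal b * volume L ≤ volume S := by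
  obtain ⟨k, hkK, hk⟩ := hK.exists_isGreatest hK0
  obtain ⟨l, hlL, hl⟩ := hL.exists_isLeast hL0
  rw [← volume_image_mul_add ha (b * l) K, ← volume_image_mul_add hb (a * k) L,
    ← measure_union₀]
  · refine measure_mono (Set.union_subset ?_ ?_)
    · rintro _ ⟨x, hx, rfl⟩
      exact h x hx l hlL
    · rintro _ ⟨y, hy, rfl⟩
      simpa only [add_comm] using h k hkK y hy
  · exact (hL.image (by fun_prop)).measurableSet.nullMeasurableSet
  · refine measure_mono_null (t := {a * k + b * l}) ?_ (by simp)
    rintro _ ⟨⟨x, hx, rfl⟩, ⟨y, hy, hxy⟩⟩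
    have h1 := mul_le_mul_of_nonneg_left (hk hx) ha.le
    have h2 := mul_le_mul_of_nonneg_left (hl hy) hb.le
    simp only [Set.mem_singleton_iff] at hxy ⊢
    linarith

lemma mul_measure_add_le_of_isCompact {A : Set ℝ} (hA : MeasurableSet A) (r c s : ℝ≥0∞)
    (h : ∀ K ⊆ A, IsCompact K → r * volume K + c ≤ s) : r * volume A + c ≤ s := by
  by_cases hs : s = ∞
  · simp [hs]
  have hc : c ≤ s := by simpa using h ∅ (Set.empty_subset _) isCompact_empty
  have hc' : c ≠ ∞ := ne_top_of_le_ne_top hs hc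
  rw [← tsub_add_cancel_of_le hc]
  gcongr
  rw [hA.measure_eq_iSup_isCompact]
  simp only [ENNReal.mul_iSup, iSup_le_iff]
  exact fun K hKA hK => ENNReal.le_sub_of_add_le_right hc' (h K hKA hK)

/-- The one-dimensional Brunn–Minkowski inequality. -/
lemma brunn_minkowski_real {a b : ℝ} (ha : 0 < a) (hb : 0 < b) {A B S : Set ℝ}
    (hA : MeasurableSet A) (hB : MeasurableSet B) (hA0 : A.Nonempty) (hB0 : B.Nonempty)
    (h : ∀ x ∈ A, ∀ y ∈ B, a * x + b * y ∈ S) :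
    ENNReal.ofReal a * volume A + ENNReal.ofReal b * volume B ≤ volume S := by
  obtain ⟨x₀, hx₀⟩ := hA0
  obtain ⟨y₀, hy₀⟩ := hB0
  refine mul_measure_add_le_of_isCompact hA _ _ _ fun K hKA hK => ?_
  rw [add_comm]
  refine mul_measure_add_le_of_isCompact hB _ _ _ fun L hLB hL => ?_
  rw [add_comm]
  have hKA' : insert x₀ K ⊆ A := Set.insert_subset hx₀ hKA
  have hLB' : insert y₀ L ⊆ B := Set.insert_subset hy₀ hLB
  calc _ ≤ ENNReal.ofReal a * volume (insert x₀ K) + ENNReal.ofReal b * volume (insert y₀ L) := by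
        gcongr <;> exact Set.subset_insert _ _
    _ ≤ _ := brunn_minkowski_real_of_isCompact ha hb (hK.insert x₀) (hL.insert y₀)
        (Set.insert_nonempty _ _) (Set.insert_nonempty _ _)
        fun x hx y hy => h x (hKA' hx) y (hLB' hy)

lemma lintegral_eq_lintegral_volume_lt_of_le_one {f : ℝ → ℝ≥0∞} (hf : Measurable f)
    (hf1 : ∀ x, f x ≤ 1) :
    ∫⁻ x, f x = ∫⁻ t in Set.Ioo (0 : ℝ) 1, volume {x | ENNReal.ofReal t < f x} := by
  have hfin x : f x ≠ ∞ := ne_top_of_le_ne_top ENNReal.one_ne_top (hf1 x)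
  have h := lintegral_eq_lintegral_meas_lt (f := fun x => (f x).toReal) volume
    (Filter.Eventually.of_forall fun _ => ENNReal.toReal_nonneg) hf.ennreal_toReal.aemeasurable
  simp only [ENNReal.ofReal_toReal (hfin _)] at h
  rw [h, ← Set.Ioo_union_Ici_eq_Ioi zero_lt_one,
    lintegral_union measurableSet_Ici (Set.disjoint_left.2 fun x hx hx' => not_le.2 hx.2 hx')]
  have h0 : ∫⁻ t in Set.Ici (1 : ℝ), volume {x | t < (f x).toReal} = 0 := by
    rw [setLIntegral_congr_fun (g := fun _ => 0) measurableSet_Ici]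
    · simp
    · intro t ht
      have : {x | t < (f x).toReal} = ∅ := by
        ext x
        simpa using (ENNReal.toReal_mono ENNReal.one_ne_top (hf1 x)).trans ht
      simp [this]
  rw [h0, add_zero]
  refine setLIntegral_congr_fun measurableSet_Ioo fun t ht => ?_
  simp only [ENNReal.ofReal_lt_iff_lt_toReal ht.1.le (hfin _)]

lemma add_lintegral_le_lintegral_of_min_le {a b : ℝ} (ha : 0 < a) (hb : 0 < b)
    {f g h : ℝ → ℝ≥0∞} (hf : Measurable f) (hg : Measurable g) (hh : Measurable h)
    (hf1 : ⨆ x, f x = 1) (hg1 : ⨆ x, g x = 1)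
    (hfgh : ∀ x y, min (f x) (g y) ≤ h (a * x + b * y)) :
    ENNReal.ofReal a * (∫⁻ x, f x) + ENNReal.ofReal b * (∫⁻ x, g x) ≤ ∫⁻ x, h x := by
  have hf' x : f x ≤ 1 := hf1 ▸ le_iSup f x
  have hg' x : g x ≤ 1 := hg1 ▸ le_iSup g x
  have hmeas (f : ℝ → ℝ≥0∞) : Measurable fun t : ℝ => volume {x | ENNReal.ofReal t < f x} :=
    Antitone.measurable fun s t hst => measure_mono fun x (hx : _ < _) =>
      (ENNReal.ofReal_le_ofReal hst).trans_lt hx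
  calc ENNReal.ofReal a * (∫⁻ x, f x) + ENNReal.ofReal b * (∫⁻ x, g x)
    _ ≤ ∫⁻ x, min (h x) 1 := by
        rw [lintegral_eq_lintegral_volume_lt_of_le_one hf hf',
          lintegral_eq_lintegral_volume_lt_of_le_one hg hg',
          lintegral_eq_lintegral_volume_lt_of_le_one (hh.min measurable_const)
            fun _ => min_le_right _ _,
          ← lintegral_const_mul _ (hmeas f), ← lintegral_const_mul _ (hmeas g),
          ← lintegral_add_left ((hmeas f).const_mul _)]
        refine setLIntegral_mono' measurableSet_Ioo fun t ht => ?_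
        have ht1 : ENNReal.ofReal t < 1 := by simpa using ht.2
        refine brunn_minkowski_real ha hb (measurableSet_lt measurable_const hf)
          (measurableSet_lt measurable_const hg) (Set.nonempty_def.2 (lt_iSup_iff.1 (ht1.trans_eq hf1.symm)))
          (Set.nonempty_def.2 (lt_iSup_iff.1 (ht1.trans_eq hg1.symm))) fun x hx y hy => ?_
        exact lt_min ((lt_min hx hy).trans_le (hfgh x y)) ht1
    _ ≤ _ := lintegral_mono fun _ => min_le_left _ _

lemma ENNReal.rpow_mul_rpow_le_add {a b : ℝ} (ha : 0 < a) (hb : 0 < b) (hab : a + b = 1)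
    (x y : ℝ≥0∞) : x ^ a * y ^ b ≤ ENNReal.ofReal a * x + ENNReal.ofReal b * y := by
  have h := ENNReal.young_inequality (x ^ a) (y ^ b) (p := a⁻¹) (q := b⁻¹)
    (Real.HolderConjugate.inv_inv ha hb hab)
  rw [← ENNReal.rpow_mul, ← ENNReal.rpow_mul, mul_inv_cancel₀ ha.ne', mul_inv_cancel₀ hb.ne',
    ENNReal.rpow_one, ENNReal.rpow_one, ENNReal.ofReal_inv_of_pos ha, ENNReal.ofReal_inv_of_pos hb,
    ENNReal.div_eq_inv_mul, ENNReal.div_eq_inv_mul, inv_inv, inv_inv] at h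
  exact h

lemma ENNReal.min_le_rpow_mul_rpow {a b : ℝ} (ha : 0 < a) (hb : 0 < b) (hab : a + b = 1)
    (x y : ℝ≥0∞) : min x y ≤ x ^ a * y ^ b := by
  calc min x y = min x y ^ a * min x y ^ b := by
        rw [← ENNReal.rpow_add_of_nonneg _ _ ha.le hb.le, hab, ENNReal.rpow_one]
    _ ≤ _ := by gcongr; exacts [min_le_left _ _, min_le_right _ _]

lemma prekopa_leindler_real_of_iSup_ne_top {a b : ℝ} (ha : 0 < a) (hb : 0 < b) (hab : a + b = 1)
    {f g h : ℝ → ℝ≥0∞} (hf : Measurable f) (hg : Measurable g) (hh : Measurable h)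
    (hf1 : ⨆ x, f x ≠ ∞) (hg1 : ⨆ x, g x ≠ ∞)
    (hfgh : ∀ x y, f x ^ a * g y ^ b ≤ h (a * x + b * y)) :
    (∫⁻ x, f x) ^ a * (∫⁻ x, g x) ^ b ≤ ∫⁻ x, h x := by
  by_cases hf0 : ⨆ x, f x = 0
  · have : ∀ x, f x = 0 := by simpa using hf0
    simp [this, ha]
  by_cases hg0 : ⨆ x, g x = 0
  · have : ∀ x, g x = 0 := by simpa using hg0
    simp [this, hb]
  set F := ⨆ x, f x
  set G := ⨆ x, g x
  set c := F ^ a * G ^ b with hc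
  have hFa0 : F ^ a ≠ 0 := by simp [hf0, hf1]
  have hGb0 : G ^ b ≠ 0 := by simp [hg0, hg1]
  have hFa : F ^ a ≠ ∞ := ENNReal.rpow_ne_top_of_nonneg ha.le hf1
  have hGb : G ^ b ≠ ∞ := ENNReal.rpow_ne_top_of_nonneg hb.le hg1
  have hc0 : c ≠ 0 := mul_ne_zero hFa0 hGb0
  have hc1 : c ≠ ∞ := ENNReal.mul_ne_top hFa hGb
  have hcinv : c⁻¹ = (F⁻¹) ^ a * (G⁻¹) ^ b := by
    rw [hc, ENNReal.mul_inv (.inl hFa0) (.inl hFa), ENNReal.inv_rpow, ENNReal.inv_rpow]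
  have key (x y : ℝ≥0∞) : (F⁻¹ * x) ^ a * (G⁻¹ * y) ^ b = c⁻¹ * (x ^ a * y ^ b) := by
    rw [ENNReal.mul_rpow_of_nonneg _ _ ha.le, ENNReal.mul_rpow_of_nonneg _ _ hb.le, hcinv]
    ring
  have main := add_lintegral_le_lintegral_of_min_le ha hb (hf.const_mul F⁻¹) (hg.const_mul G⁻¹)
    (hh.const_mul c⁻¹)
    (by rw [← ENNReal.mul_iSup]; exact ENNReal.inv_mul_cancel hf0 hf1)
    (by rw [← ENNReal.mul_iSup]; exact ENNReal.inv_mul_cancel hg0 hg1)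
    (fun x y => (ENNReal.min_le_rpow_mul_rpow ha hb hab _ _).trans
      (by rw [key]; gcongr; exact hfgh x y))
  rw [lintegral_const_mul _ hf, lintegral_const_mul _ hg, lintegral_const_mul _ hh] at main
  have := (ENNReal.rpow_mul_rpow_le_add ha hb hab _ _).trans main
  rw [key] at this
  exact (ENNReal.mul_le_mul_iff_right (ENNReal.inv_ne_zero.2 hc1) (ENNReal.inv_ne_top.2 hc0)).1 this

lemma ENNReal.rpow_lintegral_eq_iSup_min {α : Type*} [MeasurableSpace α] (μ : Measure α) {a : ℝ}
    (ha : 0 < a) {f : α → ℝ≥0∞} (hf : Measurable f) :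
    (∫⁻ x, f x ∂μ) ^ a = ⨆ n : ℕ, (∫⁻ x, min (f x) n ∂μ) ^ a := by
  have h x : f x = ⨆ n : ℕ, min (f x) n := by
    rw [← inf_iSup_eq, ENNReal.iSup_natCast, inf_top_eq]
  conv_lhs => enter [1, 2, x]; rw [h]
  rw [lintegral_iSup (fun n => hf.min measurable_const)
    (fun m n hmn x => min_le_min_left _ (by exact_mod_cast hmn))]
  exact (ENNReal.orderIsoRpow a ha).map_iSup _

/-- The one-dimensional Prékopa–Leindler inequality. -/
lemma prekopa_leindler_real {a b : ℝ} (ha : 0 < a) (hb : 0 < b) (hab : a + b = 1)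
    {f g h : ℝ → ℝ≥0∞} (hf : Measurable f) (hg : Measurable g) (hh : Measurable h)
    (hfgh : ∀ x y, f x ^ a * g y ^ b ≤ h (a * x + b * y)) :
    (∫⁻ x, f x) ^ a * (∫⁻ x, g x) ^ b ≤ ∫⁻ x, h x := by
  rw [ENNReal.rpow_lintegral_eq_iSup_min _ ha hf, ENNReal.rpow_lintegral_eq_iSup_min _ hb hg,
    ENNReal.iSup_mul]
  refine iSup_le fun n => ?_
  rw [ENNReal.mul_iSup]
  refine iSup_le fun k => ?_
  refine prekopa_leindler_real_of_iSup_ne_top ha hb hab (hf.min measurable_const)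
    (hg.min measurable_const) hh
    (ne_top_of_le_ne_top (ENNReal.natCast_ne_top n) (iSup_le fun _ => min_le_right _ _))
    (ne_top_of_le_ne_top (ENNReal.natCast_ne_top k) (iSup_le fun _ => min_le_right _ _))
    fun x y => le_trans ?_ (hfgh x y)
  gcongr <;> exact min_le_left _ _

lemma lintegral_fin_succ {m : ℕ} {f : (Fin (m + 1) → ℝ) → ℝ≥0∞} (hf : Measurable f) :
    ∫⁻ x, f x = ∫⁻ t : ℝ, ∫⁻ y : Fin m → ℝ, f (Fin.cons t y) := by
  have h := (volume_preserving_piFinSuccAbove (fun _ : Fin (m + 1) => ℝ) 0).symm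
  rw [← h.lintegral_comp hf, Measure.volume_eq_prod,
    lintegral_prod (fun p => f _) (hf.comp (MeasurableEquiv.measurable _)).aemeasurable]
  simp [MeasurableEquiv.piFinSuccAbove_symm_apply, Fin.insertNthEquiv]

lemma measurable_finCons_prod {m : ℕ} :
    Measurable fun p : ℝ × (Fin m → ℝ) => (Fin.cons p.1 p.2 : Fin (m + 1) → ℝ) := by
  refine measurable_pi_lambda _ fun i => ?_
  refine Fin.cases ?_ (fun j => ?_) i
  · simpa using measurable_fst
  · simp only [Fin.cons_succ]
    fun_prop

/-- The Prékopa–Leindler inequality. -/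
theorem prekopa_leindler {a b : ℝ} (ha : 0 < a) (hb : 0 < b) (hab : a + b = 1) :
    ∀ {m : ℕ} {f g h : (Fin m → ℝ) → ℝ≥0∞}, Measurable f → Measurable g → Measurable h →
      (∀ x y, f x ^ a * g y ^ b ≤ h (a • x + b • y)) →
      (∫⁻ x, f x) ^ a * (∫⁻ x, g x) ^ b ≤ ∫⁻ x, h x := by
  intro m
  induction m with
  | zero =>
    intro f g h _ _ _ hfgh
    have hvol : volume (Set.univ : Set (Fin 0 → ℝ)) = 1 := by simp [volume_pi]
    rw [lintegral_unique, lintegral_unique, lintegral_unique, hvol, mul_one, mul_one, mul_one]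
    refine (hfgh _ _).trans_eq (congrArg h (Subsingleton.elim _ _))
  | succ m ih =>
    intro f g h hf hg hh hfgh
    rw [lintegral_fin_succ hf, lintegral_fin_succ hg, lintegral_fin_succ hh]
    have hcons (t : ℝ) : Measurable fun y : Fin m → ℝ => (Fin.cons t y : Fin (m + 1) → ℝ) :=
      measurable_finCons_prod.comp measurable_prodMk_left
    refine prekopa_leindler_real ha hb hab
      (hf.comp measurable_finCons_prod).lintegral_prod_right'
      (hg.comp measurable_finCons_prod).lintegral_prod_right'
      (hh.comp measurable_finCons_prod).lintegral_prod_right' fun s t => ?_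
    refine ih (hf.comp (hcons s)) (hg.comp (hcons t)) (hh.comp (hcons _)) fun x y => ?_
    refine (hfgh (Fin.cons s x) (Fin.cons t y)).trans_eq (congrArg h ?_)
    ext i
    refine Fin.cases ?_ (fun j => ?_) i <;> simp

section RandomUtility

variable {m : ℕ} {f : Fin m → ℝ → ℝ}

lemma isOpen_setOf_ranking (π : Equiv.Perm (Fin m)) :
    IsOpen {x : Fin m → ℝ | ∀ k l : Fin m, k < l → x (π l) < x (π k)} := by
  simp only [Set.ofPred_forall]
  refine isOpen_iInter_of_finite fun k => isOpen_iInter_of_finite fun l =>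
    isOpen_iInter_of_finite fun _ => isOpen_lt (by fun_prop) (by fun_prop)

lemma nonempty_setOf_ranking (π : Equiv.Perm (Fin m)) :
    {x : Fin m → ℝ | ∀ k l : Fin m, k < l → x (π l) < x (π k)}.Nonempty :=
  ⟨fun j => -((π.symm j : ℕ) : ℝ), fun k l hkl => by simpa using hkl⟩

lemma integrable_prod_sub (hint : ∀ j, Integrable (f j)) (θ : Fin m → ℝ) :
    Integrable fun x : Fin m → ℝ => ∏ j, f j (x j - θ j) :=
  Integrable.fintype_prod (f := fun j t => f j (t - θ j)) fun j => (hint j).comp_sub_right (θ j)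

lemma rumProb_pos (hpos : ∀ j x, 0 < f j x) (hint : ∀ j, Integrable (f j)) (θ : Fin m → ℝ)
    (π : Equiv.Perm (Fin m)) : 0 < rumProb f θ π := by
  have hprod (x : Fin m → ℝ) : 0 < ∏ j, f j (x j - θ j) := Finset.prod_pos fun j _ => hpos _ _
  rw [rumProb, setIntegral_pos_iff_support_of_nonneg_ae
    (Filter.Eventually.of_forall fun x => (hprod x).le) (integrable_prod_sub hint θ).integrableOn,
    Function.support_eq_univ fun x => (hprod x).ne', Set.univ_inter]
  exact (isOpen_setOf_ranking π).measure_pos _ (nonempty_setOf_ranking π)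

lemma ofReal_rumProb (hpos : ∀ j x, 0 < f j x) (hint : ∀ j, Integrable (f j)) (θ : Fin m → ℝ)
    (π : Equiv.Perm (Fin m)) :
    ENNReal.ofReal (rumProb f θ π) =
      ∫⁻ x, {x : Fin m → ℝ | ∀ k l : Fin m, k < l → x (π l) < x (π k)}.indicator
        (fun x => ENNReal.ofReal (∏ j, f j (x j - θ j))) x := by
  rw [rumProb, ofReal_integral_eq_lintegral_ofReal (integrable_prod_sub hint θ).integrableOn
    (Filter.Eventually.of_forall fun x => Finset.prod_nonneg fun j _ => (hpos _ _).le),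
    lintegral_indicator (isOpen_setOf_ranking π).measurableSet]

lemma prod_rpow_mul_prod_rpow_le (hpos : ∀ j x, 0 < f j x) {a b : ℝ}
    (hf : ∀ j u v, f j u ^ a * f j v ^ b ≤ f j (a * u + b * v)) (x y θ η : Fin m → ℝ) :
    (∏ j, f j (x j - θ j)) ^ a * (∏ j, f j (y j - η j)) ^ b ≤
      ∏ j, f j ((a • x + b • y) j - (a • θ + b • η) j) := by
  rw [← Real.finsetProd_rpow _ _ fun j _ => (hpos _ _).le,
    ← Real.finsetProd_rpow _ _ fun j _ => (hpos _ _).le, ← Finset.prod_mul_distrib]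
  refine Finset.prod_le_prod (fun j _ => ?_) fun j _ => (hf j _ _).trans_eq (congrArg (f j) ?_)
  · have := hpos j (x j - θ j)
    have := hpos j (y j - η j)
    positivity
  · simp only [Pi.add_apply, Pi.smul_apply, smul_eq_mul]
    ring

lemma rumProb_rpow_mul_rumProb_rpow_le (hpos : ∀ j x, 0 < f j x) (hint : ∀ j, Integrable (f j))
    (hmeas : ∀ j, Measurable (f j)) {a b : ℝ} (ha : 0 < a) (hb : 0 < b) (hab : a + b = 1)
    (hf : ∀ j u v, f j u ^ a * f j v ^ b ≤ f j (a * u + b * v)) (θ η : Fin m → ℝ)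
    (π : Equiv.Perm (Fin m)) :
    rumProb f θ π ^ a * rumProb f η π ^ b ≤ rumProb f (a • θ + b • η) π := by
  have hθ := rumProb_pos hpos hint θ π
  have hη := rumProb_pos hpos hint η π
  have hm (θ : Fin m → ℝ) : Measurable
      ({x : Fin m → ℝ | ∀ k l : Fin m, k < l → x (π l) < x (π k)}.indicator
        fun x => ENNReal.ofReal (∏ j, f j (x j - θ j))) := by
    refine Measurable.indicator ?_ (isOpen_setOf_ranking π).measurableSet
    fun_prop
  rw [← ENNReal.ofReal_le_ofReal_iff (rumProb_pos hpos hint _ π).le,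
    ENNReal.ofReal_mul (by positivity), ← ENNReal.ofReal_rpow_of_pos hθ,
    ← ENNReal.ofReal_rpow_of_pos hη, ofReal_rumProb hpos hint, ofReal_rumProb hpos hint,
    ofReal_rumProb hpos hint]
  refine prekopa_leindler ha hb hab (hm _) (hm _) (hm _) fun x y => ?_
  by_cases hx : x ∈ {x : Fin m → ℝ | ∀ k l : Fin m, k < l → x (π l) < x (π k)}
  swap
  · rw [Set.indicator_of_notMem hx]
    simp [ha]
  by_cases hy : y ∈ {x : Fin m → ℝ | ∀ k l : Fin m, k < l → x (π l) < x (π k)}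
  swap
  · rw [Set.indicator_of_notMem hy]
    simp [hb]
  have hxy : a • x + b • y ∈ {x : Fin m → ℝ | ∀ k l : Fin m, k < l → x (π l) < x (π k)} :=
    fun k l hkl => add_lt_add (mul_lt_mul_of_pos_left (hx k l hkl) ha)
      (mul_lt_mul_of_pos_left (hy k l hkl) hb)
  have hprod (x θ : Fin m → ℝ) : 0 < ∏ j, f j (x j - θ j) := Finset.prod_pos fun j _ => hpos _ _
  rw [Set.indicator_of_mem hx, Set.indicator_of_mem hy, Set.indicator_of_mem hxy,
    ENNReal.ofReal_rpow_of_pos (hprod _ _), ENNReal.ofReal_rpow_of_pos (hprod _ _),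
    ← ENNReal.ofReal_mul (Real.rpow_nonneg (hprod _ _).le _)]
  exact ENNReal.ofReal_le_ofReal (prod_rpow_mul_prod_rpow_le hpos hf x y θ η)

/-- If the noise densities are positive and log-concave, then the log-probability of a ranking is
concave in the location parameters. -/
theorem concaveOn_log_rumProb (hpos : ∀ j x, 0 < f j x) (hint : ∀ j, Integrable (f j))
    (hmeas : ∀ j, Measurable (f j))
    (hf : ∀ a b : ℝ, 0 < a → 0 < b → a + b = 1 →
      ∀ j u v, f j u ^ a * f j v ^ b ≤ f j (a * u + b * v))
    (π : Equiv.Perm (Fin m)) :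
    ConcaveOn ℝ Set.univ fun θ => Real.log (rumProb f θ π) := by
  refine concaveOn_iff_forall_pos.2 ⟨convex_univ, fun θ _ η _ a b ha hb hab => ?_⟩
  have hθ := rumProb_pos hpos hint θ π
  have hη := rumProb_pos hpos hint η π
  rw [smul_eq_mul, smul_eq_mul, ← Real.log_rpow hθ, ← Real.log_rpow hη,
    ← Real.log_mul (by positivity) (by positivity)]
  exact Real.log_le_log (by positivity)
    (rumProb_rpow_mul_rumProb_rpow_le hpos hint hmeas ha hb hab (hf a b ha hb hab) θ η π)

end RandomUtility

lemma const_mul_exp_rpow_mul_le {c s a b : ℝ} (hc : 0 < c) (ha : 0 < a) (hb : 0 < b)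
    (hab : a + b = 1) (u v : ℝ) :
    (c * Real.exp (-u ^ 2 / (2 * s ^ 2))) ^ a * (c * Real.exp (-v ^ 2 / (2 * s ^ 2))) ^ b ≤
      c * Real.exp (-(a * u + b * v) ^ 2 / (2 * s ^ 2)) := by
  rw [Real.mul_rpow hc.le (Real.exp_pos _).le, Real.mul_rpow hc.le (Real.exp_pos _).le,
    ← Real.exp_mul, ← Real.exp_mul, mul_mul_mul_comm, ← Real.rpow_add hc, hab, Real.rpow_one,
    ← Real.exp_add]
  gcongr
  rw [div_mul_eq_mul_div, div_mul_eq_mul_div, ← add_div]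
  gcongr
  obtain rfl : b = 1 - a := by linarith
  nlinarith [mul_nonneg (mul_nonneg ha.le hb.le) (sq_nonneg (u - v))]

/-- For the Gaussian location-family RUM with fixed positive standard deviations,
the log-likelihood of any data of rankings is concave in `θ` on `ℝ^m`. -/
theorem stmt3 (m n : ℕ) (σ : Fin m → ℝ) (hσ : ∀ j, 0 < σ j)
    (D : Fin n → Equiv.Perm (Fin m)) :
    ConcaveOn ℝ Set.univ (fun θ : Fin m → ℝ =>
      ∑ i, Real.log (rumProb
        (fun j x => (1 / (σ j * Real.sqrt (2 * Real.pi))) *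
          Real.exp (-x ^ 2 / (2 * (σ j) ^ 2)))
        θ (D i))) := by
  have hc (j : Fin m) : 0 < 1 / (σ j * Real.sqrt (2 * Real.pi)) := by
    have := hσ j
    positivity
  have hconc (i : Fin n) := concaveOn_log_rumProb
    (f := fun j x => (1 / (σ j * Real.sqrt (2 * Real.pi))) *
      Real.exp (-x ^ 2 / (2 * (σ j) ^ 2)))
    (fun j x => mul_pos (hc j) (Real.exp_pos _))
    (fun j => by
      have hs : 0 < (2 * σ j ^ 2)⁻¹ := by
        have := hσ j
        positivity
      refine ((integrable_exp_neg_mul_sq hs).congr (.of_forall fun x => ?_)).const_mul _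
      exact congrArg Real.exp (by ring))
    (fun j => by fun_prop)
    (fun a b ha hb hab j u v => const_mul_exp_rpow_mul_le (hc j) ha hb hab u v) (D i)
  refine ⟨convex_univ, fun θ _ η _ a b ha hb hab => ?_⟩
  rw [Finset.smul_sum, Finset.smul_sum, ← Finset.sum_add_distrib]
  exact Finset.sum_le_sum fun i _ =>
    (hconc i).2 (Set.mem_univ θ) (Set.mem_univ η) ha hb hab
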